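/- Let U ⊆ ℤ and let (U_α)_{α ∈ A} be a family of subsets of U with U = ⋃_α U_α. Assume that for every α_1, α_2 ∈ A and every pair of distinct elements a_1 ∈ U_{α_1} and a_2 ∈ U_{α_2}, the intersection U_{α_1} ∩ U_{α_2} contains infinitely many terms of the arithmetic progression {a_1 + k·(a_2 − a_1) : k ∈ ℤ}. Then a function f : U → ℤ is LIP on U if and only if its restriction to each U_α is LIP on U_α. -/

import Mathlib

/-- A function `f` is locally integer polynomial (LIP) on `U ⊆ ℤ` if its restriction
to every finite subset of `U` agrees with some integer polynomial. -/
def IsLIP (U : Set ℤ) (f : ℤ → ℤ) : Prop :=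
  ∀ X : Finset ℤ, ↑X ⊆ U → ∃ p : Polynomial ℤ, ∀ x ∈ X, p.eval x = f x

open Polynomial in
/-- An integer polynomial vanishing on a finite set `Z` takes at `a` a value divisible by
`∏ z ∈ Z, (a - z)`. -/
lemma prod_sub_dvd_eval_of_eval_eq_zero (Z : Finset ℤ) (p : ℤ[X])
    (hp : ∀ z ∈ Z, p.eval z = 0) (a : ℤ) : ∏ z ∈ Z, (a - z) ∣ p.eval a := by
  classical
  induction Z using Finset.induction_on generalizing p with
  | empty => simp
  | insert w Z hw ih =>
    obtain ⟨q, rfl⟩ := dvd_iff_isRoot.mpr (hp w (Finset.mem_insert_self w Z))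
    rw [Finset.prod_insert hw, eval_mul, eval_sub, eval_X, eval_C]
    refine mul_dvd_mul_left _ (ih q fun z hz => ?_)
    have h := hp z (Finset.mem_insert_of_mem hz)
    rw [eval_mul, eval_sub, eval_X, eval_C, mul_eq_zero, sub_eq_zero] at h
    exact h.resolve_left fun e => hw (e ▸ hz)

/-- If every `a - y` with `y ∈ Y` divides `a - z` for infinitely many `z ∈ S`, then
`∏ y ∈ Y, (a - y)` divides `∏ z ∈ Z, (a - z)` for some finite `Z ⊆ S`. -/
lemma exists_finset_prod_sub_dvd (S : Set ℤ) (a : ℤ) (Y : Finset ℤ)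
    (hY : ∀ y ∈ Y, {z ∈ S | a - y ∣ a - z}.Infinite) :
    ∃ Z : Finset ℤ, ↑Z ⊆ S ∧ ∏ y ∈ Y, (a - y) ∣ ∏ z ∈ Z, (a - z) := by
  classical
  induction Y using Finset.induction_on with
  | empty => exact ⟨∅, by simp, by simp⟩
  | insert y Y hy ih =>
    obtain ⟨Z, hZS, hZ⟩ := ih fun x hx => hY x (Finset.mem_insert_of_mem hx)
    obtain ⟨z, ⟨hzS, hz⟩, hzZ⟩ := (hY y (Finset.mem_insert_self y Y)).exists_notMem_finset Z
    refine ⟨insert z Z, ?_, ?_⟩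
    · rw [Finset.coe_insert]
      exact Set.insert_subset hzS hZS
    · rw [Finset.prod_insert hy, Finset.prod_insert hzZ]
      exact mul_dvd_mul hz hZ

lemma IsLIP.mono {U V : Set ℤ} {f : ℤ → ℤ} (hf : IsLIP U f) (h : V ⊆ U) : IsLIP V f :=
  fun X hX => hf X (hX.trans h)

open Polynomial in
/-- A function that is LIP on `V` and on `W` is LIP on `V` together with a point `a ∈ W`, provided
`V ∩ W` has infinitely many elements congruent to `a` modulo each nonzero `a - y`, `y ∈ V`. -/
lemma IsLIP.insert_of_infinite {V W : Set ℤ} {f : ℤ → ℤ} {a : ℤ} (hV : IsLIP V f)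
    (hW : IsLIP W f) (ha : a ∈ W)
    (h : ∀ y ∈ V, y ≠ a → {z ∈ V ∩ W | a - y ∣ a - z}.Infinite) :
    IsLIP (insert a V) f := by
  classical
  intro X hX
  have hYV : ∀ y ∈ X.erase a, y ∈ V := fun y hy =>
    (hX (Finset.mem_of_mem_erase hy)).resolve_left (Finset.ne_of_mem_erase hy)
  obtain ⟨Z, hZ, hdvd⟩ := exists_finset_prod_sub_dvd (V ∩ W) a (X.erase a)
    fun y hy => h y (hYV y hy) (Finset.ne_of_mem_erase hy)
  obtain ⟨P, hP⟩ := hV (X.erase a ∪ Z) fun x hx => by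
    rcases Finset.mem_union.mp hx with hx | hx
    exacts [hYV x hx, (hZ hx).1]
  obtain ⟨Q, hQ⟩ := hW (insert a Z) fun x hx => by
    rcases Finset.mem_insert.mp hx with rfl | hx
    exacts [ha, (hZ hx).2]
  obtain ⟨c, hc⟩ := hdvd.trans <| prod_sub_dvd_eval_of_eval_eq_zero Z (Q - P) (fun z hz => by
    rw [eval_sub, hQ z (Finset.mem_insert_of_mem hz), hP z (Finset.mem_union_right _ hz),
      sub_self]) a
  rw [eval_sub, hQ a (Finset.mem_insert_self a Z)] at hc
  refine ⟨P + (∏ y ∈ X.erase a, (Polynomial.X - C y)) * C c, fun x hx => ?_⟩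
  simp only [eval_add, eval_mul, eval_prod, eval_sub, eval_X, eval_C]
  by_cases hxa : x = a
  · subst hxa
    linarith
  · have hx' := Finset.mem_erase.mpr ⟨hxa, hx⟩
    rw [Finset.prod_eq_zero hx' (sub_self x), hP x (Finset.mem_union_left _ hx')]
    ring

open Polynomial in
/-- If `f` is LIP on `insert a V`, then its difference quotient at `a` is LIP on `V \ {a}`. -/
lemma IsLIP.differenceQuotient {V : Set ℤ} {f : ℤ → ℤ} {a : ℤ} (hf : IsLIP (insert a V) f) :
    IsLIP (V \ {a}) fun y => (f y - f a) / (y - a) := by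
  classical
  intro Y hY
  obtain ⟨p, hp⟩ := hf (insert a Y) (by
    rw [Finset.coe_insert]
    exact Set.insert_subset_insert (hY.trans Set.sdiff_subset))
  obtain ⟨q, hq⟩ := X_sub_C_dvd_sub_C_eval (p := p) (a := a)
  refine ⟨q, fun y hy => ?_⟩
  have h := congrArg (eval y) hq
  rw [eval_sub, eval_C, eval_mul, eval_sub, eval_X, eval_C, hp y (Finset.mem_insert_of_mem hy),
    hp a (Finset.mem_insert_self a Y)] at h
  exact (Int.ediv_eq_of_eq_mul_right (sub_ne_zero.mpr (hY hy).2) h).symm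

lemma IsLIP.sub_dvd_sub {U : Set ℤ} {f : ℤ → ℤ} (hf : IsLIP U f) {x y : ℤ} (hx : x ∈ U)
    (hy : y ∈ U) : x - y ∣ f x - f y := by
  obtain ⟨p, hp⟩ := hf {x, y} (by simp [Set.insert_subset_iff, hx, hy])
  rw [← hp x (by simp), ← hp y (by simp)]
  exact p.sub_dvd_eval_sub x y

open Polynomial in
lemma exists_eval_eq_of_forall_isLIP {A : Type*} (X : Finset ℤ) (Uf : A → Set ℤ)
    (hint : ∀ α₁ α₂ : A, ∀ a₁ ∈ Uf α₁, ∀ a₂ ∈ Uf α₂, a₁ ≠ a₂ →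
      {x ∈ Uf α₁ ∩ Uf α₂ | ∃ k : ℤ, x = a₁ + k * (a₂ - a₁)}.Infinite)
    (f : ℤ → ℤ) (hf : ∀ α, IsLIP (Uf α) f) (hX : ∀ x ∈ X, ∃ α, x ∈ Uf α) :
    ∃ p : ℤ[X], ∀ x ∈ X, p.eval x = f x := by
  classical
  induction X using Finset.induction_on generalizing Uf f with
  | empty => exact ⟨0, by simp⟩
  | insert a Y ha ih =>
    obtain ⟨β, hβ⟩ := hX a (Finset.mem_insert_self a Y)
    have hins : ∀ α, IsLIP (insert a (Uf α)) f := fun α =>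
      (hf α).insert_of_infinite (hf β) hβ fun y hy hya =>
        (hint α β y hy a hβ hya).mono <| by
          rintro z ⟨hz, k, rfl⟩
          exact ⟨hz, 1 - k, by ring⟩
    obtain ⟨q, hq⟩ := ih (fun α => Uf α \ {a}) (fun α₁ α₂ a₁ h₁ a₂ h₂ hne =>
        ((hint α₁ α₂ a₁ h₁.1 a₂ h₂.1 hne).sdiff (Set.finite_singleton a)).mono <| by
          rintro z ⟨⟨⟨hz₁, hz₂⟩, hk⟩, hza⟩
          exact ⟨⟨⟨hz₁, hza⟩, hz₂, hza⟩, hk⟩)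
      (fun y => (f y - f a) / (y - a)) (fun α => (hins α).differenceQuotient)
      (fun y hy => (hX y (Finset.mem_insert_of_mem hy)).imp fun α hα =>
        ⟨hα, fun e => ha (e ▸ hy)⟩)
    refine ⟨C (f a) + (X - C a) * q, fun x hx => ?_⟩
    simp only [eval_add, eval_mul, eval_sub, eval_X, eval_C]
    rcases Finset.mem_insert.mp hx with rfl | hxY
    · ring
    · obtain ⟨α, hα⟩ := hX x hx
      rw [hq x hxY, Int.mul_ediv_cancel' ((hins α).sub_dvd_sub (Set.mem_insert_of_mem a hα)
        (Set.mem_insert a _))]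
      ring

/-- let `U = ⋃_α U_α` with the property that for any `α₁, α₂` and any
distinct `a₁ ∈ U_{α₁}`, `a₂ ∈ U_{α₂}`, the intersection `U_{α₁} ∩ U_{α₂}` contains
infinitely many terms of the arithmetic progression `a₁ + (a₂ − a₁)ℤ`. Then
`f : U → ℤ` is LIP on `U` iff its restriction to each `U_α` is LIP. -/
theorem stmt_18 {A : Type*} (U : Set ℤ) (Uf : A → Set ℤ)
    (hcover : U = ⋃ α, Uf α)
    (hint : ∀ α₁ α₂ : A, ∀ a₁ ∈ Uf α₁, ∀ a₂ ∈ Uf α₂, a₁ ≠ a₂ →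
      {x ∈ Uf α₁ ∩ Uf α₂ | ∃ k : ℤ, x = a₁ + k * (a₂ - a₁)}.Infinite)
    (f : ℤ → ℤ) :
    IsLIP U f ↔ ∀ α, IsLIP (Uf α) f := by
  subst hcover
  exact ⟨fun hf α => hf.mono (Set.subset_iUnion Uf α), fun hf X hX =>
    exists_eval_eq_of_forall_isLIP X Uf hint f hf fun x hx => Set.mem_iUnion.mp (hX hx)⟩
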